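/- arXiv:2211.16886 — 2 statements merged into one kernel-verified Lean document; each statement's English description precedes it below -/
import Mathlib

section
/- For every probability distribution Γ over [0,1]×{0,1}, the squared Laplace-kernel calibration error K_Lap(Γ) satisfies: K_Lap(Γ) ≥ 0, smCE(Γ)² ≤ 9·K_Lap(Γ), and K_Lap(Γ) ≤ ldCE(Γ). (Equivalently, in terms of kCE^Lap(Γ) := √(K_Lap(Γ)): (1/3)·smCE(Γ) ≤ kCE^Lap(Γ) ≤ √(ldCE(Γ)).) -/
open MeasureTheory Set

noncomputable section

/-- The unit interval `[0,1]` as a type. -/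
abbrev I01 : Type := unitInterval

/-- The real value of a Boolean label. -/
def lbl (y : Bool) : ℝ := if y then 1 else 0

/-- The calibration correlation `E_{(v,y)∼Γ}[(y − v)·w(v)]` against a weight function `w`. -/
def calErr (Γ : Measure (I01 × Bool)) (w : I01 → ℝ) : ℝ :=
  ∫ p, (lbl p.2 - (p.1 : ℝ)) * w p.1 ∂Γ

/-- A prediction-label distribution `Γ` on `[0,1] × {0,1}` is perfectly calibrated iff
`E[(y − v)·w(v)] = 0` for every bounded measurable weight function `w`. -/
def PerfCal (Γ : Measure (I01 × Bool)) : Prop :=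
  ∀ w : I01 → ℝ, Measurable w → (∃ C : ℝ, ∀ t, |w t| ≤ C) → calErr Γ w = 0

/-- `ext(Γ)`: couplings `Π` of triples `(u,v,y)` whose `(v,y)`-marginal is `Γ` and whose
`(u,y)`-marginal is perfectly calibrated. -/
def extSet (Γ : Measure (I01 × Bool)) : Set (Measure (I01 × I01 × Bool)) :=
  {π | IsProbabilityMeasure π ∧
    π.map (fun p => (p.2.1, p.2.2)) = Γ ∧
    PerfCal (π.map (fun p => (p.1, p.2.2)))}

/-- The lower distance to calibration `ldCE(Γ)`. -/
def ldCE (Γ : Measure (I01 × Bool)) : ℝ :=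
  sInf {x | ∃ π ∈ extSet Γ, x = ∫ p, |(p.1 : ℝ) - (p.2.1 : ℝ)| ∂π}

/-- The upper distance to calibration `udCE(Γ)`: distance to calibration via post-processing. -/
def udCE (Γ : Measure (I01 × Bool)) : ℝ :=
  sInf {x | ∃ κ : I01 → I01, Measurable κ ∧
    PerfCal (Γ.map (fun p => (κ p.1, p.2))) ∧
    x = ∫ p, |(p.1 : ℝ) - (κ p.1 : ℝ)| ∂Γ}

/-- The smooth calibration error `smCE(Γ)`: supremum of `E[(y−v)w(v)]` over `1`-Lipschitz
weight functions `w : [0,1] → [−1,1]`. -/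
def smCE (Γ : Measure (I01 × Bool)) : ℝ :=
  sSup {x | ∃ w : I01 → ℝ, LipschitzWith 1 w ∧ (∀ t, |w t| ≤ 1) ∧ x = calErr Γ w}

/-- The prediction-label distribution `D_f` induced by a predictor `f`. -/
def predDist {𝒳 : Type*} [MeasurableSpace 𝒳] (D : Measure (𝒳 × Bool)) (f : 𝒳 → I01) :
    Measure (I01 × Bool) :=
  D.map (fun p => (f p.1, p.2))

/-- `cal(D)`: the set of measurable predictors that are perfectly calibrated w.r.t. `D`. -/
def calSet {𝒳 : Type*} [MeasurableSpace 𝒳] (D : Measure (𝒳 × Bool)) : Set (𝒳 → I01) :=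
  {g | Measurable g ∧ PerfCal (predDist D g)}

/-- The true (ℓ₁) distance to calibration `dCE_D(f)`. -/
def dCE {𝒳 : Type*} [MeasurableSpace 𝒳] (D : Measure (𝒳 × Bool)) (f : 𝒳 → I01) : ℝ :=
  sInf {x | ∃ g ∈ calSet D, x = ∫ p, |(f p.1 : ℝ) - (g p.1 : ℝ)| ∂D}

/-- A finite partition of `[0,1]` into (order-convex) intervals. -/
structure IntervalPartition where
  m : ℕ
  piece : Fin m → Set ℝ
  ordConn : ∀ j, (piece j).OrdConnected
  disj : ∀ i j, i ≠ j → Disjoint (piece i) (piece j)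
  cover : (⋃ j, piece j) = Set.Icc (0 : ℝ) 1

/-- `binnedECE(Γ, 𝓘) = Σ_j |E[(v − y)·1(v ∈ I_j)]|`. -/
def binnedECE (Γ : Measure (I01 × Bool)) (P : IntervalPartition) : ℝ :=
  ∑ j : Fin P.m,
    |∫ p, Set.indicator (P.piece j) (fun _ => ((p.1 : ℝ) - lbl p.2)) (p.1 : ℝ) ∂Γ|

/-- The average interval width `w_Γ(𝓘) = Σ_j E[1(v ∈ I_j)]·w(I_j)`. -/
def avgWidth (Γ : Measure (I01 × Bool)) (P : IntervalPartition) : ℝ :=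
  ∑ j : Fin P.m,
    (∫ p, Set.indicator (P.piece j) (fun _ => (1 : ℝ)) (p.1 : ℝ) ∂Γ) * Metric.diam (P.piece j)

/-- The interval calibration error `intCE(Γ)`. -/
def intCE (Γ : Measure (I01 × Bool)) : ℝ :=
  sInf {x | ∃ P : IntervalPartition, x = binnedECE Γ P + avgWidth Γ P}

/-- The random interval calibration error `RintCE(Γ, ε)`, with `r` uniform on `[0, ε)` and
intervals `I^ε_{r,j} = [r + jε, r + (j+1)ε)`. -/
def RintCE (Γ : Measure (I01 × Bool)) (ε : ℝ) : ℝ :=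
  (1 / ε) * ∫ r in Set.Ico (0 : ℝ) ε,
    ∑' j : ℤ, |∫ p, Set.indicator (Set.Ico (r + (j : ℝ) * ε) (r + ((j : ℝ) + 1) * ε))
      (fun _ => (lbl p.2 - (p.1 : ℝ))) (p.1 : ℝ) ∂Γ|

/-- The surrogate interval calibration error `SintCE(Γ)`. -/
def SintCE (Γ : Measure (I01 × Bool)) : ℝ :=
  ⨅ k : ℕ, (RintCE Γ ((1 / 2) ^ k) + (1 / 2) ^ k)

/-- The squared Laplace-kernel calibration error:
`K_Lap(Γ) = E[(y−v)(y′−v′)·exp(−|v−v′|)]` over two independent samples from `Γ`. -/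
def KLap (Γ : Measure (I01 × Bool)) : ℝ :=
  ∫ q, (lbl q.1.2 - (q.1.1 : ℝ)) * (lbl q.2.2 - (q.2.1 : ℝ)) *
    Real.exp (-|(q.1.1 : ℝ) - (q.2.1 : ℝ)|) ∂(Γ.prod Γ)

/-- The squared Gaussian-kernel calibration error:
`K_Gauss(Γ) = E[(y−v)(y′−v′)·exp(−(v−v′)²)]` over two independent samples from `Γ`. -/
def KGauss (Γ : Measure (I01 × Bool)) : ℝ :=
  ∫ q, (lbl q.1.2 - (q.1.1 : ℝ)) * (lbl q.2.2 - (q.2.1 : ℝ)) *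
    Real.exp (-(((q.1.1 : ℝ) - (q.2.1 : ℝ)) ^ 2)) ∂(Γ.prod Γ)


lemma concave_quad (A B C U x : ℝ) (hC : 0 ≤ C) (hA : 0 ≤ A) (hU : 0 ≤ A + B * U - C * U ^ 2)
    (hx : 0 ≤ x) (hxU : x ≤ U) : 0 ≤ A + B * x - C * x ^ 2 := by
  rcases eq_or_lt_of_le (hx.trans hxU) with h | h
  · have : x = 0 := by linarith
    subst this; simpa using hA
  · have h1 : 0 ≤ U * (A + B * x - C * x ^ 2) := by
      have e : U * (A + B * x - C * x ^ 2) =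
          (U - x) * A + x * (A + B * U - C * U ^ 2) + C * U * x * (U - x) := by ring
      rw [e]
      have := sub_nonneg.2 hxU
      positivity
    exact nonneg_of_mul_nonneg_right h1 h

lemma kineq_aux1 (u α β : ℝ) (hu0 : 0 ≤ u) (hu1 : u ≤ 1) (hα : 0 ≤ α) (hαu : α ≤ u) (hβ : 0 ≤ β)
    (hβu : β ≤ 1 - u) :
    (u * α - (1 - u) * β) ^ 2 + 2 * (u * (1 - u + α)) * ((1 - u) * (u + β)) * (α + β)
      ≤ u * α + (1 - u) * β := by
  obtain ⟨q, hq⟩ : ∃ q, q = 1 - u := ⟨_, rfl⟩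
  have hu : u = 1 - q := by linarith
  rw [← hq] at hβu ⊢
  have hq0 : 0 ≤ q := by linarith
  have hq1 : q ≤ 1 := by linarith
  have huq : 0 ≤ u * q := mul_nonneg hu0 hq0
  have huq4 : 4 * (u * q) ≤ 1 := by rw [hu]; nlinarith [sq_nonneg (2 * q - 1)]
  -- value at `α = 0`
  have hA : 0 ≤ q * β * (1 - q * β - 2 * u * q * (u + β)) := by
    have hb : 0 ≤ 1 - q * β - 2 * u * q * (u + β) := by
      have h1 : β * (q + 2 * u * q) ≤ q * (q + 2 * u * q) :=
        mul_le_mul_of_nonneg_right hβu (by nlinarith)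
      have h2 : 1 - q * q - 2 * u * q * (u + q) = u ^ 2 := by rw [hu]; ring
      nlinarith [sq_nonneg u]
    positivity
  have hB : 0 ≤ (u ^ 2 * q ^ 2) +
      (q + 2 * u ^ 2 * q - 2 * u * q * (u + u)) * β - (q ^ 2 + 2 * u * q) * β ^ 2 := by
    apply concave_quad _ _ _ q _ (by positivity) (by positivity) _ hβ hβu
    apply le_of_eq
    rw [hu]; ring
  have hC := concave_quad (q * β * (1 - q * β - 2 * u * q * (u + β)))
    (u + 2 * u * q * β - 2 * u * q * (u + β) * (q + β)) (u ^ 2 + 2 * u * q * (u + β)) u α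
    (by positivity) hA (by
      refine hB.trans (le_of_eq ?_)
      rw [hu]; ring) hα hαu
  nlinarith [hC]

lemma kineq_aux2 (u α β : ℝ) (hu0 : 0 ≤ u) (hu1 : u ≤ 1) (hα : 0 ≤ α) (hαu : α ≤ 1 - u) (hβ : 0 ≤ β)
    (hβu : β ≤ 1 - u) :
    (u * α + (1 - u) * β) ^ 2 + 2 * (u * (1 - u - α)) * ((1 - u) * (u + β)) * |α - β|
      ≤ u * α + (1 - u) * β := by
  obtain ⟨q, hq⟩ : ∃ q, q = 1 - u := ⟨_, rfl⟩
  have hu : u = 1 - q := by linarith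
  rw [← hq] at hβu hαu ⊢
  have hq0 : 0 ≤ q := by linarith
  have hq1 : q ≤ 1 := by linarith
  have huq : 0 ≤ u * q := mul_nonneg hu0 hq0
  have huq4 : 4 * (u * q) ≤ 1 := by rw [hu]; nlinarith [sq_nonneg (2 * q - 1)]
  rcases le_total α β with h | h
  · rw [abs_of_nonpos (by linarith)]
    have hA : 0 ≤ q * β * (1 - q * β - 2 * u * q * (u + β)) := by
      have hb : 0 ≤ 1 - q * β - 2 * u * q * (u + β) := by
        have h1 : β * (q + 2 * u * q) ≤ q * (q + 2 * u * q) :=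
          mul_le_mul_of_nonneg_right hβu (by nlinarith)
        have h2 : 1 - q * q - 2 * u * q * (u + q) = u ^ 2 := by rw [hu]; ring
        nlinarith [sq_nonneg u]
      positivity
    have hC := concave_quad (q * β * (1 - q * β - 2 * u * q * (u + β)))
      (u - 2 * u * q * β + 2 * u * q * (u + β) * (q + β)) (u ^ 2 + 2 * u * q * (u + β)) β α
      (by positivity) hA (by
        have e : β * (1 - β) = q * β * (1 - q * β - 2 * u * q * (u + β)) +
          (u - 2 * u * q * β + 2 * u * q * (u + β) * (q + β)) * β -
            (u ^ 2 + 2 * u * q * (u + β)) * β ^ 2 := by rw [hu]; ring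
        rw [← e]
        exact mul_nonneg hβ (by linarith)) hα h
    nlinarith [hC]
  · rw [abs_of_nonneg (by linarith)]
    have hD : u * α + q * β ≤ α := by
      have : q * β ≤ q * α := mul_le_mul_of_nonneg_left h hq0
      have e : u * α + q * α = α := by rw [hu]; ring
      linarith
    have hD0 : 0 ≤ u * α + q * β := by positivity
    have h1 : (u * α + q * β) * (1 - α) ≤ (u * α + q * β) * (1 - (u * α + q * β)) :=
      mul_le_mul_of_nonneg_left (by linarith) hD0
    have h2 : 2 * (u * q) * (u + β) * (α - β) ≤ u * α + q * β := by
      have a1 : (u + β) * (α - β) ≤ u * α + β * α := by nlinarith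
      have a2 : (u * q) * ((u + β) * (α - β)) ≤ (u * q) * (u * α + β * α) :=
        mul_le_mul_of_nonneg_left a1 huq
      have a3 : (4 * (u * q)) * (u * α) ≤ 1 * (u * α) :=
        mul_le_mul_of_nonneg_right huq4 (by positivity)
      have a4 : (u * α) * (q * β) ≤ (u * q) * (q * β) :=
        mul_le_mul_of_nonneg_right (mul_le_mul_of_nonneg_left hαu hu0) (by positivity)
      have a5 : (4 * (u * q)) * (q * β) ≤ 1 * (q * β) :=
        mul_le_mul_of_nonneg_right huq4 (by positivity)
      have : 0 ≤ u * α := by positivity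
      have : 0 ≤ q * β := by positivity
      nlinarith
    have h3 : (q - α) * (2 * (u * q) * (u + β) * (α - β)) ≤
        (1 - α) * (2 * (u * q) * (u + β) * (α - β)) := by
      have := sub_nonneg.2 h
      exact mul_le_mul_of_nonneg_right (by linarith) (by positivity)
    have h4 : (1 - α) * (2 * (u * q) * (u + β) * (α - β)) ≤ (1 - α) * (u * α + q * β) :=
      mul_le_mul_of_nonneg_left h2 (by linarith)
    nlinarith

lemma kineq_aux3 (u α β : ℝ) (hu0 : 0 ≤ u) (hu1 : u ≤ 1) (hα : 0 ≤ α) (hαu : α ≤ 1 - u) (hβ : 0 ≤ β)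
    (hβu : β ≤ u) :
    (u * α - (1 - u) * β) ^ 2 + 2 * (u * (1 - u - α)) * ((1 - u) * (u - β)) * (α + β)
      ≤ u * α + (1 - u) * β := by
  obtain ⟨q, hq⟩ : ∃ q, q = 1 - u := ⟨_, rfl⟩
  have hu : u = 1 - q := by linarith
  rw [← hq] at hαu ⊢
  have hq0 : 0 ≤ q := by linarith
  have hq1 : q ≤ 1 := by linarith
  have huq : 0 ≤ u * q := mul_nonneg hu0 hq0
  have huq4 : 4 * (u * q) ≤ 1 := by rw [hu]; nlinarith [sq_nonneg (2 * q - 1)]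
  have hx : 0 ≤ u * α := by positivity
  have hy : 0 ≤ q * β := by positivity
  have hx4 : u * α ≤ 1 / 4 := by nlinarith [mul_le_mul_of_nonneg_left hαu hu0]
  have hy4 : q * β ≤ 1 / 4 := by nlinarith [mul_le_mul_of_nonneg_left hβu hq0]
  have b1 : (u * α - q * β) ^ 2 ≤ (1 / 4) * (u * α) + (1 / 4) * (q * β) := by
    nlinarith [mul_nonneg hx hy]
  have c1 : (q - α) * (u - β) ≤ q * u :=
    mul_le_mul (by linarith) (by linarith) (by linarith) hq0
  have c2 : (u * q) * ((q - α) * (u - β)) ≤ (u * q) * (q * u) := mul_le_mul_of_nonneg_left c1 huq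
  have c3 : (u * q) * ((q - α) * (u - β)) * (α + β) ≤ (u * q) * (q * u) * (α + β) :=
    mul_le_mul_of_nonneg_right c2 (by linarith)
  have c4 : (u * q) * (q * u) * α ≤ 1 / 4 * (u * α) := by
    have : (u * q) * q ≤ 1 / 4 * 1 := mul_le_mul (by linarith) hq1 hq0 (by norm_num)
    nlinarith [mul_le_mul_of_nonneg_right this hx]
  have c5 : (u * q) * (q * u) * β ≤ 1 / 4 * (q * β) := by
    have : (u * q) * u ≤ 1 / 4 * 1 := mul_le_mul (by linarith) hu1 hu0 (by norm_num)
    nlinarith [mul_le_mul_of_nonneg_right this hy]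
  nlinarith

lemma kineq_lin (u a b : ℝ) (hu0 : 0 ≤ u) (hu1 : u ≤ 1) (ha0 : 0 ≤ a) (ha1 : a ≤ 1)
    (hb0 : 0 ≤ b) (hb1 : b ≤ 1) :
    (u * (1 - a) - (1 - u) * b) ^ 2 + 2 * (u * (1 - a)) * ((1 - u) * b) * |a - b|
      ≤ u * |u - a| + (1 - u) * |u - b| := by
  rcases le_total a u with h1 | h1 <;> rcases le_total b u with h2 | h2
  · have := kineq_aux2 (1 - u) (u - b) (u - a) (by linarith) (by linarith) (by linarith)
      (by linarith) (by linarith) (by linarith)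
    rw [abs_of_nonneg (by linarith : 0 ≤ u - a), abs_of_nonneg (by linarith : 0 ≤ u - b)]
    rw [show u - b - (u - a) = a - b by ring] at this
    linarith
  · have := kineq_aux1 u (u - a) (b - u) (by linarith) (by linarith) (by linarith)
      (by linarith) (by linarith) (by linarith)
    rw [abs_of_nonneg (by linarith : 0 ≤ u - a), abs_of_nonpos (by linarith : u - b ≤ 0),
      abs_of_nonpos (by linarith : a - b ≤ 0)]
    linarith
  · have := kineq_aux3 u (a - u) (u - b) (by linarith) (by linarith) (by linarith)
      (by linarith) (by linarith) (by linarith)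
    rw [abs_of_nonpos (by linarith : u - a ≤ 0), abs_of_nonneg (by linarith : 0 ≤ u - b),
      abs_of_nonneg (by linarith : 0 ≤ a - b)]
    linarith
  · have := kineq_aux2 u (a - u) (b - u) (by linarith) (by linarith) (by linarith)
      (by linarith) (by linarith) (by linarith)
    rw [abs_of_nonpos (by linarith : u - a ≤ 0), abs_of_nonpos (by linarith : u - b ≤ 0)]
    rw [show a - u - (b - u) = a - b by ring] at this
    linarith

lemma kineq (u a b : ℝ) (hu0 : 0 ≤ u) (hu1 : u ≤ 1) (ha0 : 0 ≤ a) (ha1 : a ≤ 1)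
    (hb0 : 0 ≤ b) (hb1 : b ≤ 1) :
    (u * (1 - a)) ^ 2 + ((1 - u) * b) ^ 2
      - 2 * (u * (1 - a)) * ((1 - u) * b) * Real.exp (-|a - b|)
      ≤ u * |u - a| + (1 - u) * |u - b| := by
  have h := kineq_lin u a b hu0 hu1 ha0 ha1 hb0 hb1
  have h2 := Real.add_one_le_exp (-|a - b|)
  have h3 : 0 ≤ (u * (1 - a)) * ((1 - u) * b) :=
    mul_nonneg (mul_nonneg hu0 (by linarith)) (mul_nonneg (by linarith) hb0)
  nlinarith [mul_le_mul_of_nonneg_left h2 h3]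

abbrev HH : Type := Lp ℝ 2 (volume : Measure ℝ)

def feat0 (v : ℝ) : ℝ → ℝ := (Iic v).indicator (fun t => √2 * Real.exp (t - v))

lemma feat0_mul_ind (v : ℝ) (s : Set ℝ) (g : ℝ → ℝ) :
    (fun t => s.indicator g t * feat0 v t) =
      (s ∩ Iic v).indicator (fun t => g t * (√2 * Real.exp (t - v))) := by
  funext t
  simp only [feat0, Set.inter_indicator_mul]

lemma feat0_mul (v v' : ℝ) :
    (fun t => feat0 v t * feat0 v' t) =
      (Iic (min v v')).indicator (fun t => (2 * Real.exp (-v - v')) * Real.exp (2 * t)) := by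
  have := feat0_mul_ind v' (Iic v) (fun t => √2 * Real.exp (t - v))
  rw [Iic_inter_Iic] at this
  change (fun t => (Iic v).indicator _ t * feat0 v' t) = _
  rw [this]
  congr 1
  funext t
  have h : Real.exp (t - v) * Real.exp (t - v') = Real.exp (-v - v') * Real.exp (2 * t) := by
    rw [← Real.exp_add, ← Real.exp_add]; ring_nf
  have h2 : √2 * √2 = 2 := Real.mul_self_sqrt (by norm_num)
  calc _ = (√2 * √2) * (Real.exp (t - v) * Real.exp (t - v')) := by ring
    _ = _ := by rw [h, h2]; ring

lemma feat0_meas (v : ℝ) : Measurable (feat0 v) := by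
  unfold feat0
  exact Measurable.indicator (by fun_prop) measurableSet_Iic

lemma feat0_memLp (v : ℝ) : MemLp (feat0 v) 2 volume := by
  rw [memLp_two_iff_integrable_sq (feat0_meas v).aestronglyMeasurable]
  have : (fun t => feat0 v t ^ 2) = fun t => feat0 v t * feat0 v t := by
    funext t; ring
  rw [this, feat0_mul, integrable_indicator_iff measurableSet_Iic]
  exact (integrableOn_exp_mul_Iic (by norm_num) _).const_mul _

def feat (v : ℝ) : HH := (feat0_memLp v).toLp _

lemma inner_toLp (f g : ℝ → ℝ) (hf : MemLp f 2 volume) (hg : MemLp g 2 volume) :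
    inner ℝ (hf.toLp f : HH) (hg.toLp g) = ∫ t, f t * g t := by
  rw [L2.inner_def]
  apply integral_congr_ae
  filter_upwards [hf.coeFn_toLp, hg.coeFn_toLp] with t h1 h2
  rw [h1, h2]
  simp [mul_comm]

lemma inner_feat (v v' : ℝ) : inner ℝ (feat v) (feat v') = Real.exp (-|v - v'|) := by
  unfold feat
  rw [inner_toLp, feat0_mul, integral_indicator measurableSet_Iic, integral_const_mul,
    integral_exp_mul_Iic (by norm_num)]
  rw [show 2 * Real.exp (-v - v') * (Real.exp (2 * min v v') / 2) =
    Real.exp (-v - v') * Real.exp (2 * min v v') by ring, ← Real.exp_add]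
  congr 1
  rcases le_total v v' with h | h
  · rw [min_eq_left h, abs_of_nonpos (by linarith)]; ring
  · rw [min_eq_right h, abs_of_nonneg (by linarith)]; ring

lemma norm_feat (v : ℝ) : ‖feat v‖ = 1 := by
  have h : ‖feat v‖ ^ 2 = 1 := by rw [← real_inner_self_eq_norm_sq, inner_feat]; simp
  nlinarith [norm_nonneg (feat v)]

lemma continuous_feat : Continuous feat := by
  rw [continuous_iff_continuousAt]
  intro v
  rw [ContinuousAt, tendsto_iff_norm_sub_tendsto_zero]
  have h : ∀ v', ‖feat v' - feat v‖ = √(2 - 2 * Real.exp (-|v' - v|)) := by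
    intro v'
    rw [← Real.sqrt_sq (norm_nonneg (feat v' - feat v)), norm_sub_sq_real, norm_feat, norm_feat,
      inner_feat]
    congr 1
    ring
  simp_rw [h]
  have : Continuous fun v' => √(2 - 2 * Real.exp (-|v' - v|)) := by fun_prop
  simpa using this.tendsto v

lemma exists_repr (w : I01 → ℝ) (hw : LipschitzWith 1 w) (hb : ∀ t, |w t| ≤ 1) :
    ∃ W : HH, ‖W‖ ≤ 3 ∧ ∀ v : I01, inner ℝ W (feat v) = w v := by
  set f : ℝ → ℝ := fun t => w (projIcc 0 1 zero_le_one t) with hf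
  have hfl : LipschitzWith 1 f := by
    have := hw.comp (LipschitzWith.projIcc (zero_le_one (α := ℝ)))
    rw [mul_one] at this
    exact this
  have hfb : ∀ t, |f t| ≤ 1 := fun t => hb _
  have hd : ∀ t, |deriv f t| ≤ 1 := fun t => by
    simpa using norm_deriv_le_of_lipschitz hfl (x₀ := t)
  have hdm : Measurable (deriv f) := measurable_deriv f
  have hfm : Measurable f := hfl.continuous.measurable
  set g : ℝ → ℝ := (Ioc 0 1).indicator (fun t => (f t + deriv f t) / √2) with hg
  have hs2 : √2 * √2 = 2 := Real.mul_self_sqrt (by norm_num)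
  have hs0 : 0 < √2 := by positivity
  have hgm : Measurable g := Measurable.indicator ((hfm.add hdm).div_const _) measurableSet_Ioc
  have hgsq : ∀ t, g t ^ 2 ≤ (Ioc (0:ℝ) 1).indicator (fun _ => (2:ℝ)) t := by
    intro t
    by_cases ht : t ∈ Ioc (0:ℝ) 1
    · simp only [hg, indicator_of_mem ht]
      rw [div_pow, Real.sq_sqrt (by norm_num), div_le_iff₀ (by norm_num)]
      have h1 := abs_le.1 (hfb t)
      have h2 := abs_le.1 (hd t)
      nlinarith
    · simp [hg, indicator_of_notMem ht]
  have hi2 : Integrable ((Ioc (0:ℝ) 1).indicator (fun _ => (2:ℝ))) := by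
    rw [integrable_indicator_iff measurableSet_Ioc]
    exact integrableOn_const (by simp)
  have hgi : Integrable (fun t => g t ^ 2) := by
    refine hi2.mono' (hgm.pow_const 2).aestronglyMeasurable (Filter.Eventually.of_forall fun t => ?_)
    rw [Real.norm_of_nonneg (sq_nonneg _)]
    exact hgsq t
  have hgL : MemLp g 2 volume := (memLp_two_iff_integrable_sq hgm.aestronglyMeasurable).2 hgi
  have hgn : ‖(hgL.toLp g : HH)‖ ^ 2 ≤ 2 := by
    rw [← real_inner_self_eq_norm_sq, inner_toLp]
    calc ∫ t, g t * g t = ∫ t, g t ^ 2 := by congr 1; funext t; ring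
      _ ≤ ∫ t, (Ioc (0:ℝ) 1).indicator (fun _ => (2:ℝ)) t := integral_mono hgi hi2 hgsq
      _ = 2 := by rw [integral_indicator measurableSet_Ioc]; simp
  refine ⟨f 0 • feat 0 + hgL.toLp g, ?_, ?_⟩
  · have h1 : ‖f 0 • feat 0‖ ≤ 1 := by
      rw [norm_smul, norm_feat, mul_one]; exact hfb 0
    have h2 : ‖(hgL.toLp g : HH)‖ ≤ 2 := by nlinarith [norm_nonneg (hgL.toLp g : HH)]
    linarith [norm_add_le (f 0 • feat 0) (hgL.toLp g : HH)]
  · intro v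
    have hv0 := v.2.1
    have hv1 := v.2.2
    have hfv : f v = w v := by simp [hf]
    rw [inner_add_left, real_inner_smul_left, inner_feat]
    conv_lhs => rw [feat]
    rw [inner_toLp, hg, feat0_mul_ind, integral_indicator (measurableSet_Ioc.inter measurableSet_Iic)]
    have hset : Ioc (0:ℝ) 1 ∩ Iic (v:ℝ) = Ioc 0 (v:ℝ) := by
      ext t; simp only [mem_inter_iff, mem_Ioc, mem_Iic]
      constructor
      · rintro ⟨⟨a, b⟩, c⟩; exact ⟨a, c⟩
      · rintro ⟨a, c⟩; exact ⟨⟨a, c.trans hv1⟩, c⟩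
    rw [hset, ← intervalIntegral.integral_of_le hv0]
    have hac1 : AbsolutelyContinuousOnInterval f 0 v :=
      (hfl.lipschitzOnWith (s := uIcc 0 (v:ℝ))).absolutelyContinuousOnInterval
    have hac2 : AbsolutelyContinuousOnInterval Real.exp 0 v := by
      obtain ⟨C, hC⟩ := (Real.contDiff_exp (n := 1)).contDiffOn.exists_lipschitzOnWith (s := uIcc 0 (v:ℝ)) (by simp) (convex_uIcc _ _) isCompact_uIcc
      exact hC.absolutelyContinuousOnInterval
    have key := hac1.integral_deriv_mul_eq_sub hac2
    have : ∀ t, (f t + deriv f t) / √2 * (√2 * Real.exp (t - v)) =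
        Real.exp (-v) * (deriv f t * Real.exp t + f t * deriv Real.exp t) := by
      intro t
      rw [Real.deriv_exp, sub_eq_add_neg t, Real.exp_add]
      field_simp
      ring
    simp_rw [this]
    rw [intervalIntegral.integral_const_mul, key, hfv]
    have he : Real.exp (-(v:ℝ)) * Real.exp v = 1 := by rw [← Real.exp_add]; simp
    simp only [zero_sub, abs_neg, abs_of_nonneg hv0, Real.exp_zero, mul_one]
    linear_combination w v * he

lemma cont_int {X E : Type*} [TopologicalSpace X] [CompactSpace X] [MeasurableSpace X]
    [OpensMeasurableSpace X] [TopologicalSpace.PseudoMetrizableSpace X]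
    [SecondCountableTopology X]
    [NormedAddCommGroup E] (μ : Measure X) [IsFiniteMeasure μ] {f : X → E} (hf : Continuous f) :
    Integrable f μ :=
  hf.integrable_of_hasCompactSupport (HasCompactSupport.of_compactSpace f)

lemma continuous_lbl : Continuous lbl := continuous_of_discreteTopology

def Phi (p : I01 × Bool) : HH := (lbl p.2 - (p.1 : ℝ)) • feat p.1

lemma continuous_Phi : Continuous Phi := by
  unfold Phi
  exact ((continuous_lbl.comp continuous_snd).sub (by fun_prop)).smul
    (continuous_feat.comp (by fun_prop))

lemma KLap_eq (Γ : Measure (I01 × Bool)) [IsProbabilityMeasure Γ] :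
    KLap Γ = ‖∫ p, Phi p ∂Γ‖ ^ 2 := by
  have hi := cont_int Γ continuous_Phi
  have : ∀ q : (I01 × Bool) × (I01 × Bool), (lbl q.1.2 - (q.1.1 : ℝ)) * (lbl q.2.2 - (q.2.1 : ℝ)) *
    Real.exp (-|(q.1.1 : ℝ) - (q.2.1 : ℝ)|) = inner ℝ (Phi q.1) (Phi q.2) := by
    intro q
    simp only [Phi, real_inner_smul_left, real_inner_smul_right, inner_feat]
    ring
  unfold KLap
  simp_rw [this]
  rw [integral_prod]
  · simp_rw [integral_inner hi]
    rw [← real_inner_self_eq_norm_sq, ← integral_inner hi]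
    congr 1
    funext x
    rw [real_inner_comm]
  · apply cont_int
    exact (continuous_Phi.comp continuous_fst).inner (continuous_Phi.comp continuous_snd)

lemma smCE_bound (Γ : Measure (I01 × Bool)) [IsProbabilityMeasure Γ] :
    smCE Γ ^ 2 ≤ 9 * KLap Γ := by
  have hi := cont_int Γ continuous_Phi
  have h : ∀ x ∈ {x | ∃ w : I01 → ℝ, LipschitzWith 1 w ∧ (∀ t, |w t| ≤ 1) ∧ x = calErr Γ w},
      x ≤ 3 * ‖∫ p, Phi p ∂Γ‖ := by
    rintro x ⟨w, hw, hb, rfl⟩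
    obtain ⟨W, hW, hr⟩ := exists_repr w hw hb
    have : calErr Γ w = inner ℝ W (∫ p, Phi p ∂Γ) := by
      rw [← integral_inner hi]
      unfold calErr
      congr 1
      funext p
      simp only [Phi, real_inner_smul_right, hr]
    rw [this]
    exact (real_inner_le_norm _ _).trans (mul_le_mul_of_nonneg_right hW (norm_nonneg _))
  have h0 : (0:ℝ) ∈ {x | ∃ w : I01 → ℝ, LipschitzWith 1 w ∧ (∀ t, |w t| ≤ 1) ∧ x = calErr Γ w} :=
    ⟨fun _ => 0, (LipschitzWith.const 0).weaken (by simp), by simp, by simp [calErr]⟩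
  have h1 : smCE Γ ≤ 3 * ‖∫ p, Phi p ∂Γ‖ := csSup_le ⟨0, h0⟩ h
  have h2 : 0 ≤ smCE Γ := le_csSup ⟨_, h⟩ h0
  rw [KLap_eq]
  nlinarith [norm_nonneg (∫ p, Phi p ∂Γ)]

lemma norm_integral_sq_le {X : Type*} [MeasurableSpace X] (ρ : Measure X) [IsProbabilityMeasure ρ]
    (f : X → HH) (hf : AEStronglyMeasurable f ρ) (g : X → ℝ) (hg : Integrable g ρ)
    (hfg : ∀ x, ‖f x‖ ^ 2 ≤ g x) : ‖∫ x, f x ∂ρ‖ ^ 2 ≤ ∫ x, g x ∂ρ := by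
  have hf2 : Integrable (fun x => ‖f x‖ ^ 2) ρ :=
    hg.mono' (hf.norm.pow 2) (Filter.Eventually.of_forall fun x => by
      rw [Real.norm_of_nonneg (sq_nonneg _)]; exact hfg x)
  have hfi : Integrable f ρ := by
    refine (hg.add (integrable_const (1:ℝ))).mono' hf (Filter.Eventually.of_forall fun x => ?_)
    have := hfg x
    simp only [Pi.add_apply]
    nlinarith [sq_nonneg (‖f x‖ - 1)]
  have h1 : ‖∫ x, f x ∂ρ‖ ≤ ∫ x, ‖f x‖ ∂ρ := norm_integral_le_integral_norm _
  have h2 : (∫ x, ‖f x‖ ∂ρ) ^ 2 ≤ ∫ x, ‖f x‖ ^ 2 ∂ρ := by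
    have := (convexOn_pow (𝕜 := ℝ) 2).map_integral_le (μ := ρ) (f := fun x => ‖f x‖)
      (by fun_prop) isClosed_Ici (Filter.Eventually.of_forall fun x => norm_nonneg _) hfi.norm hf2
    exact this
  calc ‖∫ x, f x ∂ρ‖ ^ 2 ≤ (∫ x, ‖f x‖ ∂ρ) ^ 2 := pow_le_pow_left₀ (norm_nonneg _) h1 2
    _ ≤ _ := h2
    _ ≤ _ := integral_mono hf2 hg hfg

open ProbabilityTheory

/-- The `(u,v)`-part of `π` with label `b`. -/
def piy (π : Measure (I01 × I01 × Bool)) (b : Bool) : Measure (I01 × I01) :=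
  (π.restrict {p | p.2.2 = b}).map (fun p => (p.1, p.2.1))

instance (π : Measure (I01 × I01 × Bool)) [IsProbabilityMeasure π] (b : Bool) :
    IsFiniteMeasure (piy π b) := by unfold piy; infer_instance

def dens (b : Bool) (u : I01) : NNReal := Real.toNNReal (if b then (u : ℝ) else 1 - u)

lemma meas_y (b : Bool) : MeasurableSet {p : I01 × I01 × Bool | p.2.2 = b} :=
  (measurable_snd.comp measurable_snd) (measurableSet_singleton b)

lemma dens_coe (b : Bool) (u : I01) : (dens b u : ℝ) = if b then (u : ℝ) else 1 - u := by
  unfold dens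
  rw [Real.coe_toNNReal]
  have h0 := u.2.1
  have h1 := u.2.2
  split_ifs <;> linarith

lemma meas_dens (b : Bool) : Measurable (dens b) := by
  unfold dens
  cases b <;> simp <;> fun_prop

lemma piy_fst (π : Measure (I01 × I01 × Bool)) [IsProbabilityMeasure π]
    (hc : PerfCal (π.map (fun p => (p.1, p.2.2)))) (b : Bool) :
    (piy π b).fst = (π.map (fun p => p.1)).withDensity (fun u => (dens b u : ENNReal)) := by
  ext S hS
  have hle : ∀ u, dens b u ≤ 1 := by
    intro u
    rw [← NNReal.coe_le_coe, dens_coe, NNReal.coe_one]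
    have h0 := u.2.1
    have h1 := u.2.2
    split_ifs <;> linarith
  have hfin : IsFiniteMeasure ((π.map (fun p => p.1)).withDensity
      (fun u => (dens b u : ENNReal))) := by
    apply isFiniteMeasure_withDensity
    refine ne_top_of_le_ne_top ENNReal.one_ne_top ?_
    calc ∫⁻ u, (dens b u : ENNReal) ∂(π.map (fun p => p.1)) ≤ ∫⁻ _, 1 ∂(π.map (fun p => p.1)) :=
          lintegral_mono fun u => ENNReal.coe_le_one_iff.2 (hle u)
      _ = 1 := by rw [lintegral_one, Measure.map_apply (by fun_prop) MeasurableSet.univ]; simp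
  rw [← ENNReal.toReal_eq_toReal_iff' (measure_ne_top _ _) (measure_ne_top _ _)]
  change (piy π b).fst.real S = Measure.real _ S
  have hSm : Measurable (S.indicator (1 : I01 → ℝ)) := measurable_one.indicator hS
  have hL : Measurable fun p : I01 × I01 × Bool => lbl p.2.2 :=
    continuous_lbl.measurable.comp (by fun_prop)
  have hS1 : Measurable fun p : I01 × I01 × Bool => S.indicator (1 : I01 → ℝ) p.1 :=
    hSm.comp measurable_fst
  have hbd : ∀ t, |S.indicator (1 : I01 → ℝ) t| ≤ 1 := fun t => by
    by_cases ht : t ∈ S <;> simp [ht]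
  have h := hc (S.indicator 1) hSm ⟨1, hbd⟩
  unfold calErr at h
  rw [integral_map (by fun_prop) (Measurable.aestronglyMeasurable (by
    exact ((continuous_lbl.measurable.comp measurable_snd).sub (by fun_prop)).mul
      (hSm.comp measurable_fst)))] at h
  simp only at h
  rw [← integral_indicator_one hS, ← integral_indicator_one hS,
    integral_withDensity_eq_integral_smul (meas_dens b), integral_map (f := fun x => dens b x • S.indicator (1 : I01 → ℝ) x)
      (by fun_prop) (((meas_dens b).smul hSm).aestronglyMeasurable),
    Measure.fst, integral_map (by fun_prop) hSm.aestronglyMeasurable, piy,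
    integral_map (f := fun x : I01 × I01 => S.indicator (1 : I01 → ℝ) x.1)
      (by fun_prop) (hSm.comp measurable_fst).aestronglyMeasurable,
    ← integral_indicator (meas_y b)]
  have hmulbd : ∀ (F : I01 × I01 × Bool → ℝ), Measurable F → (∀ p, |F p| ≤ 1) →
      Integrable (fun p => F p * S.indicator (1 : I01 → ℝ) p.1) π := by
    intro F hF hFb
    refine (integrable_const (1:ℝ)).mono' (hF.mul hS1).aestronglyMeasurable
      (Filter.Eventually.of_forall fun p => ?_)
    rw [Real.norm_eq_abs, abs_mul]
    exact mul_le_one₀ (hFb p) (abs_nonneg _) (hbd _)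
  have hi1 := hmulbd (fun p => if p.2.2 = b then 1 else 0)
    (Measurable.ite (meas_y b) measurable_const measurable_const)
    (fun p => by split_ifs <;> simp)
  have hi2 := hmulbd (fun p => (dens b p.1 : ℝ))
    (by have := meas_dens b; fun_prop)
    (fun p => by rw [abs_of_nonneg (NNReal.coe_nonneg _)]; exact_mod_cast hle p.1)
  have e1 : ∀ p : I01 × I01 × Bool, ({p | p.2.2 = b} : Set (I01 × I01 × Bool)).indicator
      (fun p => S.indicator (1 : I01 → ℝ) p.1) p
      = (if p.2.2 = b then 1 else 0) * S.indicator (1 : I01 → ℝ) p.1 := by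
    intro p
    by_cases hp : p.2.2 = b <;> simp [hp]
  have e2 : ∀ p : I01 × I01 × Bool, dens b p.1 • S.indicator (1 : I01 → ℝ) p.1
      = (dens b p.1 : ℝ) * S.indicator (1 : I01 → ℝ) p.1 := fun p => rfl
  simp_rw [e1, e2]
  rw [← sub_eq_zero, ← integral_sub hi1 hi2]
  cases b
  · rw [← neg_eq_zero, ← integral_neg]
    refine Eq.trans ?_ h
    congr 1
    funext p
    rcases p with ⟨u, v, _ | _⟩ <;> simp only [dens_coe, lbl] <;> simp <;> ring
  · refine Eq.trans ?_ h
    congr 1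
    funext p
    rcases p with ⟨u, v, _ | _⟩ <;> simp only [dens_coe, lbl] <;> simp <;> ring

lemma integral_piy {E : Type*} [NormedAddCommGroup E] [NormedSpace ℝ E] (π : Measure (I01 × I01 × Bool)) [IsProbabilityMeasure π] (b : Bool)
    {f : I01 × I01 → E} (hf : Continuous f) :
    ∫ z, f z ∂(piy π b) = ∫ p in {p | p.2.2 = b}, f (p.1, p.2.1) ∂π := by
  unfold piy
  rw [integral_map (by fun_prop) hf.aestronglyMeasurable]

/-- The glued law of `(u, a, b)`. -/
def glue (π : Measure (I01 × I01 × Bool)) [IsProbabilityMeasure π] : Measure (I01 × I01 × I01) :=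
  (π.map (fun p => p.1)) ⊗ₘ ((piy π true).condKernel ×ₖ (piy π false).condKernel)

instance (π : Measure (I01 × I01 × Bool)) [IsProbabilityMeasure π] :
    IsProbabilityMeasure (π.map (fun p => p.1)) :=
  Measure.isProbabilityMeasure_map (by fun_prop)

instance (π : Measure (I01 × I01 × Bool)) [IsProbabilityMeasure π] :
    IsProbabilityMeasure (glue π) := by unfold glue; infer_instance

lemma integral_piy_cond {E : Type*} [NormedAddCommGroup E] [NormedSpace ℝ E] [CompleteSpace E]
    (π : Measure (I01 × I01 × Bool)) [IsProbabilityMeasure π]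
    (hc : PerfCal (π.map (fun p => (p.1, p.2.2)))) (b : Bool)
    {f : I01 × I01 → E} (hf : Continuous f) :
    ∫ z, f z ∂(piy π b) =
      ∫ u, (dens b u : ℝ) • ∫ a, f (u, a) ∂((piy π b).condKernel u) ∂(π.map (fun p => p.1)) := by
  conv_lhs => rw [← (piy π b).disintegrate (piy π b).condKernel]
  rw [Measure.integral_compProd (by
    rw [(piy π b).disintegrate (piy π b).condKernel]; exact cont_int _ hf), piy_fst π hc,
    integral_withDensity_eq_integral_smul (meas_dens b)]
  rfl

lemma integral_glue_true {E : Type*} [NormedAddCommGroup E] [NormedSpace ℝ E] [CompleteSpace E]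
    (π : Measure (I01 × I01 × Bool)) [IsProbabilityMeasure π]
    (hc : PerfCal (π.map (fun p => (p.1, p.2.2))))
    {f : I01 × I01 → E} (hf : Continuous f) :
    ∫ z, (z.1 : ℝ) • f (z.1, z.2.1) ∂(glue π) = ∫ p in {p | p.2.2 = true}, f (p.1, p.2.1) ∂π := by
  rw [← integral_piy π true hf, integral_piy_cond π hc true hf]
  unfold glue
  rw [Measure.integral_compProd (cont_int _ (by fun_prop))]
  congr 1
  funext u
  rw [Kernel.prod_apply, integral_fun_fst (fun a => (u:ℝ) • f (u, a)), integral_smul, dens_coe]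
  simp

lemma integral_glue_false {E : Type*} [NormedAddCommGroup E] [NormedSpace ℝ E] [CompleteSpace E]
    (π : Measure (I01 × I01 × Bool)) [IsProbabilityMeasure π]
    (hc : PerfCal (π.map (fun p => (p.1, p.2.2))))
    {f : I01 × I01 → E} (hf : Continuous f) :
    ∫ z, (1 - (z.1 : ℝ)) • f (z.1, z.2.2) ∂(glue π) =
      ∫ p in {p | p.2.2 = false}, f (p.1, p.2.1) ∂π := by
  rw [← integral_piy π false hf, integral_piy_cond π hc false hf]
  unfold glue
  rw [Measure.integral_compProd (cont_int _ (by fun_prop))]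
  congr 1
  funext u
  rw [Kernel.prod_apply, integral_fun_snd (fun a => (1 - (u:ℝ)) • f (u, a)), integral_smul, dens_coe]
  simp

lemma integral_split {E : Type*} [NormedAddCommGroup E] [NormedSpace ℝ E] [CompleteSpace E]
    (π : Measure (I01 × I01 × Bool)) [IsProbabilityMeasure π]
    (hc : PerfCal (π.map (fun p => (p.1, p.2.2))))
    {f : Bool → I01 × I01 → E} (hf : ∀ b, Continuous (f b)) :
    ∫ p, f p.2.2 (p.1, p.2.1) ∂π =
      ∫ z, ((z.1 : ℝ) • f true (z.1, z.2.1) + (1 - (z.1 : ℝ)) • f false (z.1, z.2.2)) ∂(glue π) := by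
  have h1 := hf true
  have h2 := hf false
  rw [integral_add (cont_int _ (by fun_prop)) (cont_int _ (by fun_prop)),
    integral_glue_true π hc h1, integral_glue_false π hc h2]
  have hint : Integrable (fun p : I01 × I01 × Bool => f p.2.2 (p.1, p.2.1)) π := by
    apply cont_int
    have : Continuous (fun q : Bool × (I01 × I01) => f q.1 q.2) :=
      continuous_prod_of_discrete_left.2 hf
    exact this.comp (g := fun q : Bool × (I01 × I01) => f q.1 q.2) (by fun_prop : Continuous fun p : I01 × I01 × Bool => (p.2.2, (p.1, p.2.1)))
  rw [← integral_add_compl (meas_y true) hint]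
  congr 1
  · exact setIntegral_congr_fun (meas_y true) fun p hp => by simp only [mem_ofPred_eq] at hp; simp [hp]
  · have : {p : I01 × I01 × Bool | p.2.2 = true}ᶜ = {p | p.2.2 = false} := by ext p; simp
    rw [this]
    exact setIntegral_congr_fun (meas_y false) fun p hp => by simp only [mem_ofPred_eq] at hp; simp [hp]

lemma KLap_le (Γ : Measure (I01 × Bool)) [IsProbabilityMeasure Γ] (π : Measure (I01 × I01 × Bool))
    (hπ : π ∈ extSet Γ) : KLap Γ ≤ ∫ p, |(p.1 : ℝ) - (p.2.1 : ℝ)| ∂π := by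
  obtain ⟨hp, hm, hc⟩ := hπ
  have hA := integral_split π hc (f := fun b z => Phi (z.2, b))
    (fun b => continuous_Phi.comp (by fun_prop))
  have hB := integral_split π hc (f := fun _ z => |(z.1 : ℝ) - (z.2 : ℝ)|)
    (fun b => by fun_prop)
  simp only at hA hB
  rw [KLap_eq, ← hm, integral_map (by fun_prop) continuous_Phi.aestronglyMeasurable, hA, hB]
  have hP1 : Continuous fun v : I01 => Phi (v, true) := continuous_Phi.comp (by fun_prop)
  have hP0 : Continuous fun v : I01 => Phi (v, false) := continuous_Phi.comp (by fun_prop)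
  apply norm_integral_sq_le
  · apply Continuous.aestronglyMeasurable
    exact ((by fun_prop : Continuous fun z : I01 × I01 × I01 => (z.1:ℝ)).smul (hP1.comp (by fun_prop))).add ((by fun_prop : Continuous fun z : I01 × I01 × I01 => 1 - (z.1:ℝ)).smul (hP0.comp (by fun_prop)))
  · apply cont_int
    fun_prop
  · rintro ⟨u, a, b⟩
    have := kineq u a b u.2.1 u.2.2 a.2.1 a.2.2 b.2.1 b.2.2
    simp only [Phi, lbl, smul_smul, smul_eq_mul]
    refine le_trans (le_of_eq ?_) this
    rw [norm_add_sq_real, norm_smul, norm_smul, norm_feat, norm_feat, real_inner_smul_left,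
      real_inner_smul_right, inner_feat]
    simp only [mul_one, Real.norm_eq_abs, sq_abs]
    simp
    ring

lemma extSet_nonempty (Γ : Measure (I01 × Bool)) [IsProbabilityMeasure Γ] : (extSet Γ).Nonempty := by
  have hmeas : Measurable fun p : I01 × Bool => ((if p.2 then (1 : I01) else 0), p) :=
    (((measurable_of_finite (fun b : Bool => if b then (1 : I01) else 0))).comp measurable_snd).prodMk
      measurable_id
  refine ⟨Γ.map (fun p => ((if p.2 then (1 : I01) else 0), p)),
    Measure.isProbabilityMeasure_map hmeas.aemeasurable, ?_, ?_⟩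
  · rw [Measure.map_map (by fun_prop) hmeas]
    exact Measure.map_id
  · rw [Measure.map_map (by fun_prop) hmeas]
    intro w hw _
    unfold calErr
    rw [integral_map (Measurable.aemeasurable (Measurable.comp (by fun_prop) hmeas))]
    · apply integral_eq_zero_of_ae
      refine Filter.Eventually.of_forall fun p => ?_
      rcases p with ⟨v, _ | _⟩ <;> simp [lbl]
    · apply Measurable.aestronglyMeasurable
      exact ((continuous_lbl.measurable.comp measurable_snd).sub (by fun_prop)).mul (by fun_prop)

/-- The squared Laplace-kernel calibration error satisfies
`K_Lap(Γ) ≥ 0`, `smCE(Γ)² ≤ 9·K_Lap(Γ)`, and `K_Lap(Γ) ≤ ldCE(Γ)`. -/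
theorem laplace_kernel_consistent (Γ : Measure (I01 × Bool)) [IsProbabilityMeasure Γ] :
    0 ≤ KLap Γ ∧ smCE Γ ^ 2 ≤ 9 * KLap Γ ∧ KLap Γ ≤ ldCE Γ := by
  refine ⟨?_, smCE_bound Γ, ?_⟩
  · rw [KLap_eq]; positivity
  · obtain ⟨π, hπ⟩ := extSet_nonempty Γ
    refine le_csInf ⟨_, π, hπ, rfl⟩ ?_
    rintro x ⟨π, hπ, rfl⟩
    exact KLap_le Γ π hπ
end
end

section
/- Let Π be a probability distribution over [0,1]×[0,1]×{0,1} (triples (u,v,y)), let Γ₁ be the distribution of (u,y) and Γ₂ the distribution of (v,y), and suppose E_{(u,v,y)∼Π}|u−v| ≤ ε. Then |√(K_Lap(Γ₁)) − √(K_Lap(Γ₂))| ≤ 2·√(2ε). -/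
open MeasureTheory Set

noncomputable section

lemma lbl_mem (y : Bool) : 0 ≤ lbl y ∧ lbl y ≤ 1 := by
  cases y <;> simp [lbl]

lemma measurable_lbl : Measurable lbl := measurable_of_countable _

lemma abs_lbl_sub_le (y : Bool) (u : I01) : |lbl y - (u : ℝ)| ≤ 1 := by
  have h1 := lbl_mem y
  have h2 := u.2.1
  have h3 := u.2.2
  rw [abs_le]
  constructor <;> linarith [h1.1, h1.2]

lemma sqrt_sub_abs_le (a b : ℝ) : Real.sqrt a - Real.sqrt b ≤ Real.sqrt |a - b| := by
  rw [sub_le_iff_le_add]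
  apply Real.sqrt_le_iff.2
  refine ⟨by positivity, ?_⟩
  have h1 := Real.sq_sqrt (abs_nonneg (a - b))
  have h2 : b ≤ Real.sqrt b ^ 2 := by
    rcases le_total 0 b with hb | hb
    · exact (Real.sq_sqrt hb).ge
    · exact hb.trans (sq_nonneg _)
  have h3 := le_abs_self (a - b)
  have h4 := mul_nonneg (Real.sqrt_nonneg |a - b|) (Real.sqrt_nonneg b)
  nlinarith

lemma exp_neg_abs_sub (s t : ℝ) (hs : 0 ≤ s) (ht : 0 ≤ t) :
    |Real.exp (-s) - Real.exp (-t)| ≤ |s - t| := by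
  have key : ∀ s t : ℝ, 0 ≤ s → Real.exp (-s) - Real.exp (-t) ≤ |s - t| := by
    intro s t hs
    have h1 : Real.exp (-s) ≤ 1 := Real.exp_le_one_iff.2 (by linarith)
    have h2 := Real.add_one_le_exp (s - t)
    have h3 : Real.exp (-t) = Real.exp (-s) * Real.exp (s - t) := by
      rw [← Real.exp_add]; congr 1; ring
    have h4 := Real.exp_pos (-s)
    have h5 : t - s ≤ |s - t| := by rw [abs_sub_comm]; exact le_abs_self _
    have h6 := abs_nonneg (s - t)
    rw [h3]
    nlinarith
  rw [abs_le]
  constructor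
  · have := key t s ht
    rw [abs_sub_comm] at this
    linarith
  · exact key s t hs

lemma kern_diff (a b a' b' k l : ℝ) (hb : |b| ≤ 1) (ha' : |a'| ≤ 1)
    (hb' : |b'| ≤ 1) (hk : |k| ≤ 1) :
    |a * b * k - a' * b' * l| ≤ |a - a'| + |b - b'| + |k - l| := by
  have e : a * b * k - a' * b' * l
      = (a - a') * (b * k) + (b - b') * (a' * k) + (k - l) * (a' * b') := by ring
  have m : ∀ x y z : ℝ, |y| ≤ 1 → |z| ≤ 1 → |x * (y * z)| ≤ |x| := by
    intro x y z hy hz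
    rw [abs_mul, abs_mul]
    exact mul_le_of_le_one_right (abs_nonneg _) (mul_le_one₀ hy (abs_nonneg _) hz)
  rw [e]
  refine (abs_add_three _ _ _).trans ?_
  linarith [m (a - a') b k hb hk, m (b - b') a' k ha' hk, m (k - l) a' b' ha' hb']

def ker (p q : I01 × Bool) : ℝ :=
  (lbl p.2 - (p.1 : ℝ)) * (lbl q.2 - (q.1 : ℝ)) * Real.exp (-|(p.1 : ℝ) - (q.1 : ℝ)|)

lemma measurable_ker : Measurable (fun q : (I01 × Bool) × (I01 × Bool) => ker q.1 q.2) := by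
  have := measurable_lbl
  unfold ker
  fun_prop

lemma abs_exp_le (p q : ℝ) : |Real.exp (-|p - q|)| ≤ 1 := by
  rw [abs_of_pos (Real.exp_pos _)]
  exact Real.exp_le_one_iff.2 (by linarith [abs_nonneg (p - q)])

lemma abs_ker_le (p q : I01 × Bool) : |ker p q| ≤ 1 := by
  unfold ker
  rw [abs_mul, abs_mul]
  exact mul_le_one₀ (mul_le_one₀ (abs_lbl_sub_le _ _) (abs_nonneg _) (abs_lbl_sub_le _ _))
    (abs_nonneg _) (abs_exp_le _ _)

lemma ker_diff (u u' v v' : I01) (y y' : Bool) :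
    |ker (u, y) (u', y') - ker (v, y) (v', y')|
      ≤ 2 * |(u : ℝ) - v| + 2 * |(u' : ℝ) - v'| := by
  unfold ker
  refine (kern_diff _ _ _ _ _ _ (abs_lbl_sub_le _ _) (abs_lbl_sub_le _ _)
    (abs_lbl_sub_le _ _) (abs_exp_le _ _)).trans ?_
  dsimp only
  have h1 : |lbl y - (u : ℝ) - (lbl y - v)| = |(u : ℝ) - v| := by
    rw [abs_sub_comm]; congr 1; ring
  have h2 : |lbl y' - (u' : ℝ) - (lbl y' - v')| = |(u' : ℝ) - v'| := by
    rw [abs_sub_comm]; congr 1; ring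
  have h3 := exp_neg_abs_sub |(u : ℝ) - u'| |(v : ℝ) - v'| (abs_nonneg _) (abs_nonneg _)
  have h4 := abs_abs_sub_abs_le_abs_sub ((u : ℝ) - u') ((v : ℝ) - v')
  have h5 : (u : ℝ) - u' - (v - v') = (u - v) - (u' - v') := by ring
  have h6 := abs_sub ((u : ℝ) - v) (u' - v')
  rw [h5] at h4
  rw [h1, h2]
  linarith

lemma KLap_map (π : Measure (I01 × I01 × Bool)) [IsProbabilityMeasure π]
    (f : I01 × I01 × Bool → I01 × Bool) (hf : Measurable f) :
    KLap (π.map f) = ∫ q, ker (f q.1) (f q.2) ∂(π.prod π) := by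
  have : KLap (π.map f) = ∫ q, ker q.1 q.2 ∂((π.map f).prod (π.map f)) := rfl
  rw [this, Measure.map_prod_map _ _ hf hf,
    integral_map (hf.prodMap hf).aemeasurable measurable_ker.aestronglyMeasurable]
  rfl

lemma integrable_ker (π : Measure (I01 × I01 × Bool)) [IsProbabilityMeasure π]
    (f : I01 × I01 × Bool → I01 × Bool) (hf : Measurable f) :
    Integrable (fun q : (I01 × I01 × Bool) × (I01 × I01 × Bool) => ker (f q.1) (f q.2))
      (π.prod π) := by
  refine Integrable.of_bound (C := 1)
    (measurable_ker.comp (hf.prodMap hf)).aestronglyMeasurable ?_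
  exact Filter.Eventually.of_forall fun q => abs_ker_le _ _

lemma KLap_diff (π : Measure (I01 × I01 × Bool)) [IsProbabilityMeasure π] :
    |KLap (π.map fun p => (p.1, p.2.2)) - KLap (π.map fun p => (p.2.1, p.2.2))|
      ≤ 4 * ∫ p, |(p.1 : ℝ) - (p.2.1 : ℝ)| ∂π := by
  have hf : Measurable (fun p : I01 × I01 × Bool => (p.1, p.2.2)) := by fun_prop
  have hg : Measurable (fun p : I01 × I01 × Bool => (p.2.1, p.2.2)) := by fun_prop
  have hd : Integrable (fun p : I01 × I01 × Bool => |(p.1 : ℝ) - (p.2.1 : ℝ)|) π := by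
    refine Integrable.of_bound (C := 1) (Measurable.aestronglyMeasurable (by fun_prop)) ?_
    refine Filter.Eventually.of_forall fun p => ?_
    rw [Real.norm_eq_abs, abs_abs, abs_le]
    have h1 := p.1.2
    have h2 := p.2.1.2
    constructor <;> linarith [h1.1, h1.2, h2.1, h2.2]
  have h1 : Integrable (fun q : (I01 × I01 × Bool) × (I01 × I01 × Bool) =>
      2 * |(q.1.1 : ℝ) - (q.1.2.1 : ℝ)|) (π.prod π) := (hd.comp_fst π).const_mul 2
  have h2 : Integrable (fun q : (I01 × I01 × Bool) × (I01 × I01 × Bool) =>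
      2 * |(q.2.1 : ℝ) - (q.2.2.1 : ℝ)|) (π.prod π) := (hd.comp_snd π).const_mul 2
  rw [KLap_map π _ hf, KLap_map π _ hg,
    ← integral_sub (integrable_ker π _ hf) (integrable_ker π _ hg)]
  refine (abs_integral_le_integral_abs).trans ?_
  refine (integral_mono ((integrable_ker π _ hf).sub (integrable_ker π _ hg)).abs (h1.add h2)
    (fun q => ker_diff q.1.1 q.2.1 q.1.2.1 q.2.2.1 q.1.2.2 q.2.2.2)).trans ?_
  have e1 := integral_fun_fst (μ := π) (ν := π)
    (fun p : I01 × I01 × Bool => |(p.1 : ℝ) - (p.2.1 : ℝ)|)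
  have e2 := integral_fun_snd (μ := π) (ν := π)
    (fun p : I01 × I01 × Bool => |(p.1 : ℝ) - (p.2.1 : ℝ)|)
  simp only [probReal_univ, one_smul] at e1 e2
  have e3 := integral_add h1 h2
  rw [integral_const_mul, integral_const_mul, e1, e2] at e3
  refine (le_of_eq e3).trans ?_
  linarith

/-- If `Π` couples `(u,y) ∼ Γ₁` with `(v,y) ∼ Γ₂` and `E|u−v| ≤ ε`, then
`|√K_Lap(Γ₁) − √K_Lap(Γ₂)| ≤ 2√(2ε)`. -/
theorem laplace_kernel_continuous (π : Measure (I01 × I01 × Bool))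
    [IsProbabilityMeasure π] (ε : ℝ)
    (h : ∫ p, |(p.1 : ℝ) - (p.2.1 : ℝ)| ∂π ≤ ε) :
    |Real.sqrt (KLap (π.map fun p => (p.1, p.2.2))) -
      Real.sqrt (KLap (π.map fun p => (p.2.1, p.2.2)))| ≤ 2 * Real.sqrt (2 * ε) := by
  have h0 : 0 ≤ ∫ p, |(p.1 : ℝ) - (p.2.1 : ℝ)| ∂π := integral_nonneg fun p => abs_nonneg _
  have hd := KLap_diff π
  have hs : (2 : ℝ) * Real.sqrt (2 * ε) = Real.sqrt (8 * ε) := by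
    rw [show (8 : ℝ) * ε = 2 ^ 2 * (2 * ε) by ring, Real.sqrt_mul (x := 2 ^ 2) (by norm_num),
      Real.sqrt_sq (by norm_num)]
  rw [hs]
  refine le_trans ?_ (Real.sqrt_le_sqrt (hd.trans (by linarith)))
  rw [abs_le]
  constructor
  · have := sqrt_sub_abs_le (KLap (π.map fun p => (p.2.1, p.2.2)))
      (KLap (π.map fun p => (p.1, p.2.2)))
    rw [abs_sub_comm] at this
    linarith
  · exact sqrt_sub_abs_le _ _
end
end
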